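/- For every F₂-linear subspace 𝒢 ⊆ F_{m,r} there exists π ∈ Sym(m,r) such that dist(𝒢, π(𝒢)) ≥ (2/9)·min( dim 𝒢, binom(m,r) − dim 𝒢 ). -/

import Mathlib

/-- Coefficient space of the degree-`r` part: `F_{m,r} ≅ F₂^{binom(m,r)}`,
with coordinates indexed by the `r`-element subsets of `[m]` (coefficients of the
squarefree monomials `x_I`, `|I| = r`). -/
abbrev Coef (m r : ℕ) := {I : Finset (Fin m) // I.card = r} → ZMod 2

/-- The Boolean function `x ↦ ∑_I c_I ∏_{i ∈ I} x_i` determined by a full coefficient vector. -/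
def evalC (m : ℕ) (c : Finset (Fin m) → ZMod 2) : (Fin m → ZMod 2) → ZMod 2 :=
  fun x => ∑ I : Finset (Fin m), c I * ∏ i ∈ I, x i

/-- The coefficient (in the multilinear expansion) of the monomial `x_I` of a Boolean
function `f`, via Möbius inversion over `F₂`: `c_I = ∑_{S ⊆ I} f(1_S)`. -/
def coefC (m : ℕ) (f : (Fin m → ZMod 2) → ZMod 2) : Finset (Fin m) → ZMod 2 :=
  fun I => ∑ S ∈ I.powerset, f (fun i => if i ∈ S then 1 else 0)

/-- Extension of a degree-`r` coefficient vector to a full coefficient vector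
(supported on the `r`-element subsets). -/
def degPart (m r : ℕ) (c : Coef m r) : Finset (Fin m) → ZMod 2 :=
  fun I => if h : I.card = r then c ⟨I, h⟩ else 0

/-- The map on degree-`r` coefficient vectors induced by the substitution `x ↦ Ax + b`:
substitute in the corresponding polynomial and keep only the degree-`r` coefficients. -/
def symMap (m r : ℕ) (A : Matrix (Fin m) (Fin m) (ZMod 2)) (b : Fin m → ZMod 2)
    (c : Coef m r) : Coef m r :=
  fun J => coefC m (fun x => evalC m (degPart m r c) (A.mulVec x + b)) J.val

/-- `symMap` as an `F₂`-linear map. -/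
noncomputable def symLin (m r : ℕ) (A : Matrix (Fin m) (Fin m) (ZMod 2)) (b : Fin m → ZMod 2) :
    Coef m r →ₗ[ZMod 2] Coef m r :=
  AddMonoidHom.toZModLinearMap 2 (AddMonoidHom.mk' (symMap m r A b) (by
    intro c c'
    funext J
    have h1 : degPart m r (c + c') = degPart m r c + degPart m r c' := by
      funext I; by_cases h : I.card = r <;> simp [degPart, h]
    have h2 : ∀ u v : Finset (Fin m) → ZMod 2, evalC m (u + v) = evalC m u + evalC m v := by
      intro u v; funext x; simp [evalC, add_mul, Finset.sum_add_distrib]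
    have h4 : ∀ f g : (Fin m → ZMod 2) → ZMod 2, coefC m (f + g) = coefC m f + coefC m g := by
      intro f g; funext I; simp [coefC, Finset.sum_add_distrib]
    show symMap m r A b (c + c') J = symMap m r A b c J + symMap m r A b c' J
    simp only [symMap, h1, h2]
    have : (fun x => (evalC m (degPart m r c) + evalC m (degPart m r c')) (A.mulVec x + b))
        = (fun x => evalC m (degPart m r c) (A.mulVec x + b))
          + (fun x => evalC m (degPart m r c') (A.mulVec x + b)) := rfl
    rw [this, h4]
    rfl))

/-- The subspace distance `dist(A,B) = dim A + dim B - 2 dim (A ∩ B)`. -/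
noncomputable def sdist {m r : ℕ} (G G' : Submodule (ZMod 2) (Coef m r)) : ℝ :=
  (Module.finrank (ZMod 2) G : ℝ) + (Module.finrank (ZMod 2) G' : ℝ)
    - 2 * (Module.finrank (ZMod 2) ↥(G ⊓ G') : ℝ)

open Module

section AlmostInvariantSubspaces

variable {K V Γ : Type*} [Field K] [AddCommGroup V] [Module K V]

/-- The subspace distance as an integer. -/
noncomputable def subspaceDist (H L : Submodule K V) : ℤ :=
  finrank K H + finrank K L - 2 * finrank K ↥(H ⊓ L)

theorem subspaceDist_sup_add_inf_le [FiniteDimensional K V] (X H L : Submodule K V) :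
    subspaceDist X (H ⊔ L) + subspaceDist X (H ⊓ L) ≤ subspaceDist X H + subspaceDist X L := by
  have hHL := Submodule.finrank_sup_add_finrank_inf_eq H L
  have hX := Submodule.finrank_sup_add_finrank_inf_eq (X ⊓ H) (X ⊓ L)
  have hinf : X ⊓ H ⊓ (X ⊓ L) = X ⊓ (H ⊓ L) := inf_inf_distrib_left X H L |>.symm
  have hsup : finrank K ↥(X ⊓ H ⊔ X ⊓ L) ≤ finrank K ↥(X ⊓ (H ⊔ L)) :=
    Submodule.finrank_mono le_inf_sup
  rw [hinf] at hX
  unfold subspaceDist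
  omega

theorem subspaceDist_map_equiv (e : V ≃ₗ[K] V) (H L : Submodule K V) :
    subspaceDist (H.map (e : V →ₗ[K] V)) (L.map (e : V →ₗ[K] V)) = subspaceDist H L := by
  unfold subspaceDist
  rw [← Submodule.map_inf _ e.injective]
  simp only [LinearEquiv.finrank_map_eq]

variable [Group Γ] [Fintype Γ]

/-- The total distance from `H` to the translates of `G` is minimised by an invariant subspace. -/
theorem exists_invariant_sum_subspaceDist_le [Finite V] (ρ : Γ →* (V ≃ₗ[K] V))
    (G : Submodule K V) :
    ∃ H : Submodule K V, (∀ h, H.map (ρ h : V →ₗ[K] V) = H) ∧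
      ∀ L : Submodule K V, ∑ g, subspaceDist (G.map (ρ g : V →ₗ[K] V)) H ≤
        ∑ g, subspaceDist (G.map (ρ g : V →ₗ[K] V)) L := by
  have : FiniteDimensional K V := Module.Finite.of_finite
  set Φ : Submodule K V → ℤ := fun L => ∑ g, subspaceDist (G.map (ρ g : V →ₗ[K] V)) L with hΦ
  obtain ⟨H, hH⟩ := Finite.exists_min fun L : Submodule K V => toLex (Φ L, finrank K L)
  have hmin (L) : Φ H ≤ Φ L := by
    rcases (Prod.Lex.le_iff ..).1 (hH L) with h | h
    exacts [h.le, h.1.le]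
  have hrank (L) (hL : Φ L ≤ Φ H) : finrank K H ≤ finrank K L := by
    rcases (Prod.Lex.le_iff ..).1 (hH L) with h | h
    exacts [absurd hL (not_le.2 h), h.2]
  have hinv (h : Γ) (L : Submodule K V) : Φ (L.map (ρ h : V →ₗ[K] V)) = Φ L := by
    simp only [hΦ]
    rw [← Equiv.sum_comp (Equiv.mulLeft h)]
    refine Finset.sum_congr rfl fun g _ => ?_
    have : G.map (ρ (h * g) : V →ₗ[K] V) =
        (G.map (ρ g : V →ₗ[K] V)).map (ρ h : V →ₗ[K] V) := by
      rw [← Submodule.map_comp, map_mul]; rfl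
    rw [Equiv.coe_mulLeft, this, subspaceDist_map_equiv]
  refine ⟨H, fun h => ?_, hmin⟩
  have hsub : Φ (H ⊔ H.map (ρ h : V →ₗ[K] V)) + Φ (H ⊓ H.map (ρ h : V →ₗ[K] V)) ≤
      Φ H + Φ (H.map (ρ h : V →ₗ[K] V)) := by
    simp only [hΦ, ← Finset.sum_add_distrib]
    exact Finset.sum_le_sum fun g _ => subspaceDist_sup_add_inf_le _ _ _
  have hle : Φ (H ⊓ H.map (ρ h : V →ₗ[K] V)) ≤ Φ H := by
    have := hmin (H ⊔ H.map (ρ h : V →ₗ[K] V))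
    have := hinv h H
    omega
  have hinf : H ⊓ H.map (ρ h : V →ₗ[K] V) = H :=
    Submodule.eq_of_le_of_finrank_le inf_le_left (hrank _ hle)
  refine (Submodule.eq_of_le_of_finrank_le (inf_eq_left.1 hinf) ?_).symm
  rw [LinearEquiv.finrank_map_eq]

/-- Under an irreducible action, some translate of `G` is far from `G`. -/
theorem exists_min_le_subspaceDist_map [Finite V] (ρ : Γ →* (V ≃ₗ[K] V))
    (hρ : ∀ H : Submodule K V, (∀ h, H.map (ρ h : V →ₗ[K] V) = H) → H = ⊥ ∨ H = ⊤)
    (G : Submodule K V) :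
    ∃ g, min (finrank K G : ℤ) (finrank K V - finrank K G) ≤
      subspaceDist G (G.map (ρ g : V →ₗ[K] V)) := by
  have : FiniteDimensional K V := Module.Finite.of_finite
  obtain ⟨H, hinv, hmin⟩ := exists_invariant_sum_subspaceDist_le ρ G
  have hconst (g : Γ) : min (finrank K G : ℤ) (finrank K V - finrank K G) ≤
      subspaceDist (G.map (ρ g : V →ₗ[K] V)) H := by
    rcases hρ H hinv with rfl | rfl
    · rw [subspaceDist, inf_bot_eq, LinearEquiv.finrank_map_eq, finrank_bot]
      omega
    · rw [subspaceDist, inf_top_eq, LinearEquiv.finrank_map_eq, finrank_top]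
      omega
  obtain ⟨g, -, hg⟩ := Finset.exists_le_of_sum_le (Finset.univ_nonempty (α := Γ))
    ((Finset.sum_le_sum fun g _ => hconst g).trans (hmin G))
  refine ⟨g, hg.trans_eq ?_⟩
  unfold subspaceDist
  rw [inf_comm, add_comm (finrank K G : ℤ)]

end AlmostInvariantSubspaces

section DegreeFiltration

variable {m : ℕ}

/-- The monomial `x_I` as a Boolean function. -/
def monomialFun (I : Finset (Fin m)) : (Fin m → ZMod 2) → ZMod 2 := fun x => ∏ i ∈ I, x i

/-- Boolean functions of degree at most `d`. -/
def degreeLE (m d : ℕ) : Submodule (ZMod 2) ((Fin m → ZMod 2) → ZMod 2) :=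
  Submodule.span (ZMod 2) (monomialFun '' {I | I.card ≤ d})

/-- `coefC` as a linear map. -/
def coefLin (m : ℕ) : ((Fin m → ZMod 2) → ZMod 2) →ₗ[ZMod 2] Finset (Fin m) → ZMod 2 where
  toFun := coefC m
  map_add' f g := by funext I; simp [coefC, Finset.sum_add_distrib]
  map_smul' a f := by funext I; simp [coefC, Finset.mul_sum]

theorem coefLin_apply (f : (Fin m → ZMod 2) → ZMod 2) : coefLin m f = coefC m f := rfl

/-- `evalC` as a linear map. -/
def evalLin (m : ℕ) : (Finset (Fin m) → ZMod 2) →ₗ[ZMod 2] (Fin m → ZMod 2) → ZMod 2 where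
  toFun := evalC m
  map_add' u v := by funext x; simp [evalC, add_mul, Finset.sum_add_distrib]
  map_smul' a u := by funext x; simp [evalC, Finset.mul_sum, mul_assoc]

theorem evalC_eq_sum (c : Finset (Fin m) → ZMod 2) : evalC m c = ∑ I, c I • monomialFun I := by
  funext x; simp [evalC, monomialFun]

theorem monomialFun_mem_degreeLE {I : Finset (Fin m)} {d : ℕ} (h : I.card ≤ d) :
    monomialFun I ∈ degreeLE m d :=
  Submodule.subset_span ⟨I, h, rfl⟩

theorem degreeLE_mono {d e : ℕ} (h : d ≤ e) : degreeLE m d ≤ degreeLE m e :=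
  Submodule.span_mono (Set.image_mono fun _ hI => le_trans hI h)

theorem coefC_monomialFun (I J : Finset (Fin m)) :
    coefC m (monomialFun I) J = if J = I then 1 else 0 := by
  have heval (S : Finset (Fin m)) :
      monomialFun I (fun i => if i ∈ S then (1 : ZMod 2) else 0) = if I ⊆ S then 1 else 0 := by
    simp only [monomialFun, Finset.prod_ite_zero, Finset.prod_const_one, Finset.subset_iff]
  simp only [coefC, heval]
  rw [← Finset.sum_filter, Finset.sum_const, nsmul_one]
  by_cases hIJ : I ⊆ J
  · have : J.powerset.filter (I ⊆ ·) = Finset.Icc I J := by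
      ext S; simp [and_comm]
    rw [this, Finset.card_Icc_finset hIJ]
    split_ifs with h
    · simp [h]
    · have hlt : I.card < J.card :=
        Finset.card_lt_card (hIJ.ssubset_of_ne (Ne.symm h))
      have h2 : (2 : ZMod 2) = 0 := rfl
      push_cast
      rw [h2, zero_pow (by omega)]
  · have : J.powerset.filter (I ⊆ ·) = ∅ := by
      ext S
      simp only [Finset.mem_filter, Finset.mem_powerset, Finset.notMem_empty, iff_false, not_and]
      exact fun h1 h2 => hIJ (h2.trans h1)
    rw [this, if_neg (by rintro rfl; exact hIJ subset_rfl)]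
    simp

theorem coefC_eq_zero_of_mem_degreeLE {d : ℕ} {f : (Fin m → ZMod 2) → ZMod 2}
    (hf : f ∈ degreeLE m d) {J : Finset (Fin m)} (hJ : d < J.card) : coefC m f J = 0 := by
  have hle : degreeLE m d ≤ LinearMap.ker (LinearMap.proj J ∘ₗ coefLin m) := by
    refine Submodule.span_le.2 ?_
    rintro _ ⟨I, hI, rfl⟩
    change coefC m (monomialFun I) J = 0
    rw [coefC_monomialFun, if_neg]
    rintro rfl
    exact absurd hI (not_le.2 hJ)
  exact hle hf

theorem evalC_coefC_of_mem_degreeLE {d : ℕ} {f : (Fin m → ZMod 2) → ZMod 2}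
    (hf : f ∈ degreeLE m d) : evalC m (coefC m f) = f := by
  have hle : degreeLE m d ≤ LinearMap.eqLocus (evalLin m ∘ₗ coefLin m) LinearMap.id := by
    refine Submodule.span_le.2 ?_
    rintro _ ⟨I, -, rfl⟩
    change evalC m (coefC m (monomialFun I)) = monomialFun I
    simp [evalC_eq_sum, coefC_monomialFun]
  exact hle hf

theorem mul_coord_mem_degreeLE {d : ℕ} {f : (Fin m → ZMod 2) → ZMod 2}
    (hf : f ∈ degreeLE m d) (j : Fin m) : (fun x => f x * x j) ∈ degreeLE m (d + 1) := by
  have hle : degreeLE m d ≤ (degreeLE m (d + 1)).comap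
      (LinearMap.mulRight (ZMod 2) fun x : Fin m → ZMod 2 => x j) := by
    refine Submodule.span_le.2 ?_
    rintro _ ⟨I, hI, rfl⟩
    change monomialFun I * (fun x => x j) ∈ degreeLE m (d + 1)
    have : monomialFun I * (fun x => x j) = monomialFun (insert j I) := by
      funext x
      by_cases hj : j ∈ I
      · have hsq : ∀ a : ZMod 2, a * a = a := by decide
        rw [Finset.insert_eq_of_mem hj]
        simp only [monomialFun, Pi.mul_apply]
        rw [← Finset.mul_prod_erase I x hj, mul_right_comm, hsq]
      · simp [monomialFun, Finset.prod_insert hj, mul_comm]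
    rw [this]
    exact monomialFun_mem_degreeLE ((Finset.card_insert_le j I).trans (Nat.succ_le_succ hI))
  exact hle hf

theorem mul_linear_mem_degreeLE {d : ℕ} {f : (Fin m → ZMod 2) → ZMod 2}
    (hf : f ∈ degreeLE m d) (a : Fin m → ZMod 2) :
    (fun x => f x * ∑ j, a j * x j) ∈ degreeLE m (d + 1) := by
  have : (fun x => f x * ∑ j, a j * x j) = ∑ j, a j • fun x => f x * x j := by
    funext x
    simp only [Finset.mul_sum, Finset.sum_apply, Pi.smul_apply, smul_eq_mul]
    exact Finset.sum_congr rfl fun j _ => by ring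
  rw [this]
  exact Submodule.sum_mem _ fun j _ => Submodule.smul_mem _ _ (mul_coord_mem_degreeLE hf j)

theorem monomialFun_comp_mem_degreeLE (A : Matrix (Fin m) (Fin m) (ZMod 2))
    (I : Finset (Fin m)) : (fun x => monomialFun I (A.mulVec x)) ∈ degreeLE m I.card := by
  induction I using Finset.induction_on with
  | empty =>
    exact monomialFun_mem_degreeLE (I := (∅ : Finset (Fin m))) le_rfl
  | insert i I hi ih =>
    rw [Finset.card_insert_of_notMem hi]
    convert mul_linear_mem_degreeLE ih (A i) using 2 with x
    simp [monomialFun, Finset.prod_insert hi, mul_comm, Matrix.mulVec, dotProduct]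

theorem comp_mem_degreeLE (A : Matrix (Fin m) (Fin m) (ZMod 2)) {d : ℕ}
    {f : (Fin m → ZMod 2) → ZMod 2} (hf : f ∈ degreeLE m d) :
    (fun x => f (A.mulVec x)) ∈ degreeLE m d := by
  have hle : degreeLE m d ≤ (degreeLE m d).comap
      (LinearMap.funLeft (ZMod 2) (ZMod 2) A.mulVec) := by
    refine Submodule.span_le.2 ?_
    rintro _ ⟨I, hI, rfl⟩
    exact degreeLE_mono hI (monomialFun_comp_mem_degreeLE A I)
  exact hle hf

theorem mem_degreeLE_of_coefC {d e : ℕ} {f : (Fin m → ZMod 2) → ZMod 2} (hf : f ∈ degreeLE m e)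
    (h : ∀ J : Finset (Fin m), d < J.card → coefC m f J = 0) : f ∈ degreeLE m d := by
  rw [← evalC_coefC_of_mem_degreeLE hf, evalC_eq_sum]
  refine Submodule.sum_mem _ fun J _ => ?_
  by_cases hJ : J.card ≤ d
  · exact Submodule.smul_mem _ _ (monomialFun_mem_degreeLE hJ)
  · simp [h J (not_le.1 hJ)]

end DegreeFiltration

section SymLin

variable {m r : ℕ}

theorem evalC_degPart_mem_degreeLE (c : Coef m r) : evalC m (degPart m r c) ∈ degreeLE m r := by
  rw [evalC_eq_sum]
  refine Submodule.sum_mem _ fun I _ => ?_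
  by_cases h : I.card = r
  · exact Submodule.smul_mem _ _ (monomialFun_mem_degreeLE h.le)
  · simp [degPart, h]

theorem coefC_evalC (c : Finset (Fin m) → ZMod 2) : coefC m (evalC m c) = c := by
  funext J
  change (LinearMap.proj J ∘ₗ coefLin m) (evalC m c) = c J
  rw [evalC_eq_sum, map_sum]
  have (I : Finset (Fin m)) : (LinearMap.proj J ∘ₗ coefLin m) (c I • monomialFun I) =
      c I * if J = I then 1 else 0 := by
    rw [map_smul, smul_eq_mul, ← coefC_monomialFun]; rfl
  simp [this]

/-- The coefficients of degree `r` of a Boolean function. -/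
def topCoef (m r : ℕ) : ((Fin m → ZMod 2) → ZMod 2) →ₗ[ZMod 2] Coef m r :=
  LinearMap.funLeft (ZMod 2) (ZMod 2) Subtype.val ∘ₗ coefLin m

theorem topCoef_apply (f : (Fin m → ZMod 2) → ZMod 2) (K : {I : Finset (Fin m) // I.card = r}) :
    topCoef m r f K = coefC m f K := rfl

theorem symLin_zero_apply (A : Matrix (Fin m) (Fin m) (ZMod 2)) (c : Coef m r) :
    symLin m r A 0 c = topCoef m r fun x => evalC m (degPart m r c) (A.mulVec x) := by
  change symMap m r A 0 c = _
  funext J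
  simp only [symMap, add_zero]
  rfl

theorem topCoef_evalC_degPart (c : Coef m r) : topCoef m r (evalC m (degPart m r c)) = c := by
  funext J
  change coefC m (evalC m (degPart m r c)) J.1 = c J
  rw [coefC_evalC, degPart, dif_pos J.2]

/-- Two functions of degree at most `r` with the same degree-`r` part still have the same
degree-`r` part after a linear substitution. -/
theorem topCoef_comp_congr (A : Matrix (Fin m) (Fin m) (ZMod 2))
    {f g : (Fin m → ZMod 2) → ZMod 2} (hf : f ∈ degreeLE m r) (hg : g ∈ degreeLE m r)
    (h : topCoef m r f = topCoef m r g) :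
    (topCoef m r fun x => f (A.mulVec x)) = topCoef m r fun x => g (A.mulVec x) := by
  have hfg := Submodule.sub_mem _ hf hg
  have hcoef (J : Finset (Fin m)) (hJ : r ≤ J.card) : coefC m (f - g) J = 0 := by
    rcases hJ.eq_or_lt with hJ | hJ
    · have := congrFun h ⟨J, hJ.symm⟩
      change coefC m f J = coefC m g J at this
      change coefLin m (f - g) J = 0
      rw [map_sub]
      exact sub_eq_zero.2 this
    · exact coefC_eq_zero_of_mem_degreeLE hfg hJ
  rw [← sub_eq_zero, ← map_sub]
  change topCoef m r (fun x => (f - g) (A.mulVec x)) = 0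
  cases r with
  | zero =>
    have : f - g = 0 := by
      rw [← evalC_coefC_of_mem_degreeLE hfg, evalC_eq_sum]
      simp [hcoef]
    rw [this]
    exact map_zero _
  | succ d =>
    have hlow := comp_mem_degreeLE A (mem_degreeLE_of_coefC (d := d) hfg fun J hJ => hcoef J hJ)
    funext J
    exact coefC_eq_zero_of_mem_degreeLE hlow (by rw [J.2]; exact Nat.lt_succ_self d)

theorem symLin_topCoef (A : Matrix (Fin m) (Fin m) (ZMod 2)) {f : (Fin m → ZMod 2) → ZMod 2}
    (hf : f ∈ degreeLE m r) :
    symLin m r A 0 (topCoef m r f) = topCoef m r fun x => f (A.mulVec x) := by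
  rw [symLin_zero_apply]
  exact topCoef_comp_congr A (evalC_degPart_mem_degreeLE _) hf (topCoef_evalC_degPart _)

theorem symLin_mul (A B : Matrix (Fin m) (Fin m) (ZMod 2)) :
    symLin m r (A * B) 0 = symLin m r B 0 ∘ₗ symLin m r A 0 := by
  refine LinearMap.ext fun c => ?_
  rw [LinearMap.comp_apply, symLin_zero_apply A,
    symLin_topCoef B (comp_mem_degreeLE A (evalC_degPart_mem_degreeLE c)), symLin_zero_apply]
  simp only [Matrix.mulVec_mulVec]

theorem symLin_one : symLin m r (1 : Matrix (Fin m) (Fin m) (ZMod 2)) 0 = LinearMap.id := by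
  refine LinearMap.ext fun c => ?_
  simp only [symLin_zero_apply, Matrix.one_mulVec]
  exact topCoef_evalC_degPart c

/-- The action of `GL_m(F₂)` on `F_{m,r}`. -/
noncomputable def symHom (m r : ℕ) :
    (Matrix (Fin m) (Fin m) (ZMod 2))ˣ →* (Coef m r ≃ₗ[ZMod 2] Coef m r) where
  toFun g := LinearEquiv.ofLinearMap (symLin m r ↑g⁻¹ 0) (symLin m r g 0)
    (by rw [← symLin_mul, Units.mul_inv, symLin_one])
    (by rw [← symLin_mul, Units.inv_mul, symLin_one])
  map_one' := by
    refine LinearEquiv.toLinearMap_injective ?_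
    change symLin m r ↑(1⁻¹ : (Matrix (Fin m) (Fin m) (ZMod 2))ˣ) 0 = LinearMap.id
    rw [inv_one, Units.val_one, symLin_one]
  map_mul' g h := by
    refine LinearEquiv.toLinearMap_injective ?_
    change symLin m r ↑(g * h)⁻¹ 0 = symLin m r ↑g⁻¹ 0 ∘ₗ symLin m r ↑h⁻¹ 0
    rw [mul_inv_rev, Units.val_mul, symLin_mul]

theorem coe_symHom (g : (Matrix (Fin m) (Fin m) (ZMod 2))ˣ) :
    (symHom m r g : Coef m r →ₗ[ZMod 2] Coef m r) = symLin m r ↑g⁻¹ 0 := rfl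

theorem coefC_monomialFun_transvection {i j : Fin m} (hij : i ≠ j) {J K : Finset (Fin m)}
    (hJK : J.card = K.card) :
    coefC m (fun x => monomialFun J ((Matrix.transvection j i (1 : ZMod 2)).mulVec x)) K =
      (if K = J then 1 else 0) +
        if i ∈ K ∧ j ∉ K ∧ J = insert j (K.erase i) then 1 else 0 := by
  have hcoord (x : Fin m → ZMod 2) (k : Fin m) :
      (Matrix.transvection j i (1 : ZMod 2)).mulVec x k = x k + if k = j then x i else 0 := by
    rw [Matrix.transvection, Matrix.add_mulVec, Matrix.one_mulVec, Pi.add_apply,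
      Matrix.single_mulVec]
    simp [Function.update_apply]
  by_cases hj : j ∈ J
  · have hfun : (fun x => monomialFun J ((Matrix.transvection j i (1 : ZMod 2)).mulVec x)) =
        monomialFun J + fun x => monomialFun (J.erase j) x * x i := by
      funext x
      simp only [monomialFun, hcoord, Pi.add_apply]
      rw [← Finset.mul_prod_erase J _ hj, ← Finset.mul_prod_erase J x hj, if_pos rfl, add_mul,
        mul_comm (x i)]
      have : ∏ k ∈ J.erase j, (x k + if k = j then x i else 0) = ∏ k ∈ J.erase j, x k :=
        Finset.prod_congr rfl fun k hk => by rw [if_neg (Finset.ne_of_mem_erase hk), add_zero]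
      rw [this]
    rw [hfun, ← coefLin_apply, map_add, Pi.add_apply, coefLin_apply, coefLin_apply,
      coefC_monomialFun]
    congr 1
    by_cases hi : i ∈ J
    · have hi' : i ∈ J.erase j := Finset.mem_erase.2 ⟨hij, hi⟩
      have hlt : (J.erase j).card < K.card := hJK ▸ Finset.card_erase_lt_of_mem hj
      have hmem : (fun x => monomialFun (J.erase j) x * x i) = monomialFun (J.erase j) := by
        have hsq : ∀ a : ZMod 2, a * a = a := by decide
        funext x
        simp only [monomialFun]
        rw [← Finset.mul_prod_erase _ x hi', mul_right_comm, hsq]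
      rw [hmem, coefC_eq_zero_of_mem_degreeLE (monomialFun_mem_degreeLE le_rfl) hlt, if_neg]
      rintro ⟨-, -, rfl⟩
      simp [hij] at hi
    · have hmem : (fun x => monomialFun (J.erase j) x * x i) =
          monomialFun (insert i (J.erase j)) := by
        funext x
        simp only [monomialFun]
        rw [Finset.prod_insert (by simp [hi]), mul_comm]
      rw [hmem, coefC_monomialFun]
      refine if_congr ⟨?_, ?_⟩ rfl rfl
      · rintro rfl
        refine ⟨by simp, by simp [hij.symm], ?_⟩
        rw [Finset.erase_insert (by simp [hi]), Finset.insert_erase hj]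
      · rintro ⟨hiK, hjK, rfl⟩
        rw [Finset.erase_insert (by simp [hjK]), Finset.insert_erase hiK]
  · have hfun : (fun x => monomialFun J ((Matrix.transvection j i (1 : ZMod 2)).mulVec x)) =
        monomialFun J := by
      funext x
      simp only [monomialFun, hcoord]
      refine Finset.prod_congr rfl fun k hk => ?_
      rw [if_neg (by rintro rfl; exact hj hk), add_zero]
    rw [hfun, coefC_monomialFun, if_neg (c := i ∈ K ∧ _), add_zero]
    rintro ⟨-, -, rfl⟩
    simp at hj

/-- A transvection acts as the identity plus the operator replacing `x_j` by `x_i`. -/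
theorem symLin_transvection_apply {i j : Fin m} (hij : i ≠ j) (c : Coef m r)
    (K : {I : Finset (Fin m) // I.card = r}) :
    symLin m r (Matrix.transvection j i 1) 0 c K =
      c K + if i ∈ K.1 ∧ j ∉ K.1 then degPart m r c (insert j (K.1.erase i)) else 0 := by
  have hsum : (fun x => evalC m (degPart m r c)
      ((Matrix.transvection j i (1 : ZMod 2)).mulVec x)) = ∑ J, degPart m r c J •
        fun x => monomialFun J ((Matrix.transvection j i (1 : ZMod 2)).mulVec x) := by
    funext x; simp [evalC, monomialFun]
  rw [symLin_zero_apply, hsum, map_sum, Finset.sum_apply]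
  have hterm (J : Finset (Fin m)) : (topCoef m r (degPart m r c J • fun x =>
      monomialFun J ((Matrix.transvection j i (1 : ZMod 2)).mulVec x))) K =
        (if K.1 = J then degPart m r c J else 0) +
          if J = insert j (K.1.erase i) then
            (if i ∈ K.1 ∧ j ∉ K.1 then degPart m r c J else 0) else 0 := by
    rw [map_smul, Pi.smul_apply, smul_eq_mul]
    by_cases hJ : J.card = r
    · rw [topCoef_apply, coefC_monomialFun_transvection hij (hJ.trans K.2.symm), mul_add]
      congr 1
      · simp
      · split_ifs <;> simp_all
    · simp [degPart, hJ]
  simp only [hterm, Finset.sum_add_distrib, Finset.sum_ite_eq, Finset.sum_ite_eq',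
    Finset.mem_univ, if_true]
  rw [degPart, dif_pos K.2]

theorem isUnit_transvection {i j : Fin m} (hij : i ≠ j) :
    IsUnit (Matrix.transvection j i (1 : ZMod 2)) := by
  rw [Matrix.isUnit_iff_isUnit_det, Matrix.det_transvection_of_ne _ _ hij.symm]
  exact isUnit_one

/-- Replacing `x_j` by `x_i` in the monomials that contain `x_j` but not `x_i`, and dropping all
other monomials, preserves `H`. -/
def PreservesSwaps (H : Submodule (ZMod 2) (Coef m r)) : Prop :=
  ∀ i j : Fin m, i ≠ j → ∀ c ∈ H, (fun K : {I : Finset (Fin m) // I.card = r} =>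
    if i ∈ K.1 ∧ j ∉ K.1 then degPart m r c (insert j (K.1.erase i)) else 0) ∈ H

theorem preservesSwaps_of_invariant {H : Submodule (ZMod 2) (Coef m r)}
    (hH : ∀ g, H.map (symHom m r g : Coef m r →ₗ[ZMod 2] Coef m r) = H) : PreservesSwaps H := by
  intro i j hij c hc
  obtain ⟨g, hg⟩ := isUnit_transvection hij
  have hmem : symLin m r (Matrix.transvection j i 1) 0 c ∈ H := by
    rw [← hH g⁻¹, coe_symHom, inv_inv, hg]
    exact Submodule.mem_map_of_mem hc
  convert H.sub_mem hmem hc using 1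
  funext K
  rw [Pi.sub_apply, symLin_transvection_apply hij, add_sub_cancel_left]

theorem PreservesSwaps.restrict_mem {H : Submodule (ZMod 2) (Coef m r)} (hH : PreservesSwaps H)
    {i j : Fin m} (hij : i ≠ j) {c : Coef m r} (hc : c ∈ H) :
    (fun K : {I : Finset (Fin m) // I.card = r} => if i ∈ K.1 ∧ j ∉ K.1 then c K else 0) ∈ H := by
  convert hH i j hij _ (hH j i hij.symm c hc) using 1
  funext K
  split_ifs with h
  · have hjK : j ∉ K.1.erase i := fun hj => h.2 (Finset.mem_of_mem_erase hj)
    have hcard : (insert j (K.1.erase i)).card = r := by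
      rw [Finset.card_insert_of_notMem hjK, Finset.card_erase_add_one h.1, K.2]
    have hback : insert i ((insert j (K.1.erase i)).erase j) = K.1 := by
      rw [Finset.erase_insert hjK, Finset.insert_erase h.1]
    rw [degPart, dif_pos hcard, if_pos ⟨by simp, by simp [hij]⟩, hback, degPart, dif_pos K.2]
  · rfl

theorem PreservesSwaps.restrict_forall_mem {H : Submodule (ZMod 2) (Coef m r)}
    (hH : PreservesSwaps H) {c : Coef m r} (hc : c ∈ H) (T : Finset (Fin m × Fin m))
    (hT : ∀ p ∈ T, p.1 ≠ p.2) :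
    (fun K : {I : Finset (Fin m) // I.card = r} =>
      if ∀ p ∈ T, p.1 ∈ K.1 ∧ p.2 ∉ K.1 then c K else 0) ∈ H := by
  induction T using Finset.induction_on with
  | empty => simpa using hc
  | insert p T hp ih =>
    have hrec := ih fun q hq => hT q (Finset.mem_insert_of_mem hq)
    convert hH.restrict_mem (hT p (Finset.mem_insert_self p T)) hrec using 1
    funext K
    rw [← ite_and]
    exact if_congr (Finset.forall_mem_insert ..) rfl rfl

theorem PreservesSwaps.single_mem {H : Submodule (ZMod 2) (Coef m r)} (hH : PreservesSwaps H)
    {c : Coef m r} (hc : c ∈ H) {I : {I : Finset (Fin m) // I.card = r}} (hI : c I ≠ 0) :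
    (Pi.single I 1 : Coef m r) ∈ H := by
  have hone : c I = 1 := Fin.eq_one_of_ne_zero _ hI
  convert hH.restrict_forall_mem hc (I.1 ×ˢ I.1ᶜ) ?_ using 1
  · funext K
    rw [Pi.single_apply, ← hone]
    by_cases hK : K = I
    · subst hK
      rw [if_pos rfl, if_pos]
      simp
    · rw [if_neg hK, if_neg]
      intro h
      refine hK (Subtype.ext ?_)
      by_cases huniv : ∃ j, j ∉ I.1
      · obtain ⟨j, hj⟩ := huniv
        refine (Finset.eq_of_subset_of_card_le (fun i hi => ?_) (K.2.trans I.2.symm).le).symm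
        exact (h (i, j) (by simp [hi, hj])).1
      · push Not at huniv
        exact Finset.eq_of_subset_of_card_le (fun i _ => huniv i) (I.2.trans K.2.symm).le
  · intro p hp hpp
    rw [Finset.mem_product, Finset.mem_compl, hpp] at hp
    exact hp.2 hp.1

theorem PreservesSwaps.single_mem_of_single_mem {H : Submodule (ZMod 2) (Coef m r)}
    (hH : PreservesSwaps H) {I : {I : Finset (Fin m) // I.card = r}}
    (hI : (Pi.single I 1 : Coef m r) ∈ H) (L : {I : Finset (Fin m) // I.card = r}) :
    (Pi.single L 1 : Coef m r) ∈ H := by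
  induction hn : (L.1 \ I.1).card generalizing L with
  | zero =>
    have hLI : L.1 ⊆ I.1 := by simpa using hn
    rwa [Subtype.ext (Finset.eq_of_subset_of_card_le hLI (I.2.trans L.2.symm).le)]
  | succ n ih =>
    have hcard : (I.1 \ L.1).card = n + 1 := by
      rw [← hn]; exact Finset.card_sdiff_comm (I.2.trans L.2.symm)
    obtain ⟨i, hi⟩ : (L.1 \ I.1).Nonempty := Finset.card_pos.1 (by omega)
    obtain ⟨j, hj⟩ : (I.1 \ L.1).Nonempty := Finset.card_pos.1 (by omega)
    rw [Finset.mem_sdiff] at hi hj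
    have hij : i ≠ j := by rintro rfl; exact hi.2 hj.1
    have hjL : j ∉ L.1.erase i := fun h => hj.2 (Finset.mem_of_mem_erase h)
    have hcardL : (insert j (L.1.erase i)).card = r := by
      rw [Finset.card_insert_of_notMem hjL, Finset.card_erase_add_one hi.1, L.2]
    have hprev := ih ⟨insert j (L.1.erase i), hcardL⟩ (by
      rw [Finset.insert_sdiff_of_mem _ hj.1, Finset.erase_sdiff_comm,
        Finset.card_erase_of_mem (Finset.mem_sdiff.2 hi), hn, Nat.add_sub_cancel])
    convert hH i j hij _ hprev using 1
    funext K
    rw [Pi.single_apply]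
    by_cases hK : i ∈ K.1 ∧ j ∉ K.1
    · have hjK : j ∉ K.1.erase i := fun h => hK.2 (Finset.mem_of_mem_erase h)
      have hcardK : (insert j (K.1.erase i)).card = r := by
        rw [Finset.card_insert_of_notMem hjK, Finset.card_erase_add_one hK.1, K.2]
      rw [if_pos hK, degPart, dif_pos hcardK, Pi.single_apply]
      refine if_congr ⟨by rintro rfl; rfl, fun h => Subtype.ext ?_⟩ rfl rfl
      have h' := congrArg (fun S => insert i (S.erase j)) (Subtype.ext_iff.1 h)
      simpa [Finset.erase_insert hjK, Finset.erase_insert hjL, Finset.insert_erase hK.1,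
        Finset.insert_erase hi.1] using h'
    · rw [if_neg hK, if_neg]
      rintro rfl
      exact hK ⟨hi.1, hj.2⟩

/-- `GL_m(F₂)` acts irreducibly on `F_{m,r}`. -/
theorem eq_bot_or_eq_top_of_invariant (H : Submodule (ZMod 2) (Coef m r))
    (hH : ∀ g, H.map (symHom m r g : Coef m r →ₗ[ZMod 2] Coef m r) = H) : H = ⊥ ∨ H = ⊤ := by
  have hswap := preservesSwaps_of_invariant hH
  refine or_iff_not_imp_left.2 fun hbot => ?_
  obtain ⟨c, hc, hc0⟩ := H.ne_bot_iff.1 hbot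
  obtain ⟨I, hI⟩ := Function.ne_iff.1 hc0
  rw [eq_top_iff, ← (Pi.basisFun (ZMod 2) _).span_eq, Submodule.span_le]
  rintro _ ⟨L, rfl⟩
  rw [Pi.basisFun_apply]
  exact hswap.single_mem_of_single_mem (hswap.single_mem hc hI) L

end SymLin

/-- for every subspace `𝒢 ⊆ F_{m,r}` there is `π ∈ Sym(m,r)` (induced by an
invertible affine substitution `x ↦ Ax + b`) with
`dist(𝒢, π(𝒢)) ≥ (2/9) · min(dim 𝒢, binom(m,r) - dim 𝒢)`. -/
theorem stmt7 (m r : ℕ) (𝒢 : Submodule (ZMod 2) (Coef m r)) :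
    ∃ (A : Matrix (Fin m) (Fin m) (ZMod 2)) (b : Fin m → ZMod 2), IsUnit A ∧
      sdist 𝒢 (Submodule.map (symLin m r A b) 𝒢)
        ≥ (2 / 9) * min ((Module.finrank (ZMod 2) 𝒢 : ℝ))
            ((m.choose r : ℝ) - (Module.finrank (ZMod 2) 𝒢 : ℝ)) := by
  obtain ⟨g, hg⟩ := exists_min_le_subspaceDist_map (symHom m r) eq_bot_or_eq_top_of_invariant 𝒢
  refine ⟨↑g⁻¹, 0, g⁻¹.isUnit, ?_⟩
  have hdim : finrank (ZMod 2) (Coef m r) = m.choose r := by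
    rw [Module.finrank_fintype_fun_eq_card, Fintype.card_finset_len, Fintype.card_fin]
  have hle : (finrank (ZMod 2) 𝒢 : ℝ) ≤ m.choose r := by
    exact_mod_cast hdim ▸ Submodule.finrank_le 𝒢
  rw [coe_symHom, hdim] at hg
  have hcast : min (finrank (ZMod 2) 𝒢 : ℝ) (m.choose r - finrank (ZMod 2) 𝒢) ≤
      sdist 𝒢 (𝒢.map (symLin m r ↑g⁻¹ 0)) := by
    have := (Int.cast_le (R := ℝ)).2 hg
    simpa [subspaceDist, sdist] using this
  have hnonneg : 0 ≤ min (finrank (ZMod 2) 𝒢 : ℝ) (m.choose r - finrank (ZMod 2) 𝒢) :=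
    le_min (Nat.cast_nonneg _) (sub_nonneg.2 hle)
  linarith
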